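/- Let n be a natural number and let He_n denote the n-th probabilists' Hermite polynomial (defined by He_0 = 1 and He_{n+1}(x) = x·He_n(x) − He_n'(x)). Define f : ℝ → ℝ by f(x) = He_n(√2·x)·exp(−x²/2). Then f is twice differentiable and for every real x, −(1/2)·f''(x) + (1/2)·x²·f(x) = (n + 1/2)·f(x). -/

import Mathlib

open Polynomial Real

/-- The Hermite differential equation `He_n'' = x·He_n' − n·He_n`. -/
theorem hermite_ode_aux (n : ℕ) :
    derivative (derivative (hermite n)) =
      X * derivative (hermite n) - (n : ℤ[X]) * hermite n := by
  induction n with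
  | zero => simp
  | succ n ih =>
    have h1 : derivative (hermite (n + 1)) = ((n : ℤ[X]) + 1) * hermite n := by
      rw [hermite_succ, derivative_sub, derivative_mul, ih, derivative_X]
      ring
    rw [h1, derivative_mul, hermite_succ]
    simp only [derivative_add, derivative_natCast, derivative_one]
    push_cast
    ring

/-- The Hermite function `f(x) = He_n(√2·x)·exp(−x²/2)` (with `He_n` the n-th
probabilists' Hermite polynomial) is twice differentiable and satisfies the
harmonic oscillator eigenvalue equation
`−(1/2)·f''(x) + (1/2)·x²·f(x) = (n + 1/2)·f(x)`. -/
theorem hermite_function_is_eigenfunction_of_harmonic_oscillator (n : ℕ) :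
    let f : ℝ → ℝ := fun x =>
      (Polynomial.aeval (Real.sqrt 2 * x) (Polynomial.hermite n)) * Real.exp (-x ^ 2 / 2)
    Differentiable ℝ f ∧ Differentiable ℝ (deriv f) ∧
      ∀ x : ℝ, -(1 / 2) * deriv (deriv f) x + (1 / 2) * x ^ 2 * f x
        = ((n : ℝ) + 1 / 2) * f x := by
  intro f
  have hs : Real.sqrt 2 * Real.sqrt 2 = 2 := Real.mul_self_sqrt (by norm_num)
  have hlin : ∀ x : ℝ, HasDerivAt (fun y : ℝ => Real.sqrt 2 * y) (Real.sqrt 2) x := by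
    intro x
    simpa using (hasDerivAt_id x).const_mul (Real.sqrt 2)
  have hp : ∀ (p : ℤ[X]) (x : ℝ), HasDerivAt (fun y : ℝ => aeval (Real.sqrt 2 * y) p)
      (aeval (Real.sqrt 2 * x) (derivative p) * Real.sqrt 2) x := by
    intro p x
    exact (p.hasDerivAt_aeval (Real.sqrt 2 * x)).comp x (hlin x)
  have he : ∀ x : ℝ, HasDerivAt (fun y : ℝ => Real.exp (-y ^ 2 / 2))
      (Real.exp (-x ^ 2 / 2) * (-x)) x := by
    intro x
    have h : HasDerivAt (fun y : ℝ => -y ^ 2 / 2) (-x) x := by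
      have h0 := ((hasDerivAt_pow 2 x).neg).div_const 2
      refine h0.congr_deriv ?_
      norm_num
      ring
    exact h.exp
  have hf : ∀ x, HasDerivAt f
      ((aeval (Real.sqrt 2 * x) (derivative (hermite n)) * Real.sqrt 2
        - x * aeval (Real.sqrt 2 * x) (hermite n)) * Real.exp (-x ^ 2 / 2)) x := by
    intro x
    refine ((hp (hermite n) x).mul (he x)).congr_deriv ?_
    ring
  have hdf : deriv f = fun x =>
      (aeval (Real.sqrt 2 * x) (derivative (hermite n)) * Real.sqrt 2
        - x * aeval (Real.sqrt 2 * x) (hermite n)) * Real.exp (-x ^ 2 / 2) :=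
    funext fun x => (hf x).deriv
  have hode : ∀ y : ℝ, aeval y (derivative (derivative (hermite n))) =
      y * aeval y (derivative (hermite n)) - (n : ℝ) * aeval y (hermite n) := by
    intro y
    rw [hermite_ode_aux]
    simp
  have hf2 : ∀ x, HasDerivAt (deriv f) ((x ^ 2 - 2 * n - 1) * f x) x := by
    intro x
    rw [hdf]
    refine (((((hp (derivative (hermite n)) x).mul_const (Real.sqrt 2)).sub
      ((hasDerivAt_id x).mul (hp (hermite n) x)))).mul (he x)).congr_deriv ?_
    simp only [f, hode, id, Pi.sub_apply, Pi.mul_apply]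
    linear_combination (Real.exp (-x ^ 2 / 2) * (Real.sqrt 2 * x *
      aeval (Real.sqrt 2 * x) (derivative (hermite n))
        - n * aeval (Real.sqrt 2 * x) (hermite n))) * hs
  refine ⟨fun x => (hf x).differentiableAt, fun x => (hf2 x).differentiableAt, fun x => ?_⟩
  rw [(hf2 x).deriv]
  ring
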